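/- arXiv:2401.04121 — 2 statements merged into one kernel-verified Lean document; each statement's English description precedes it below -/
import Mathlib

section
/- For every real κ ≠ 0, with η = κ²/8, one has ∫_0^∞ e^{−z²} z^{1/2} sin(zκ + π/4) dz = (π/16) · e^{−η} · |κ|^{3/2} · ( I_{−3/4}(η) − I_{1/4}(η) − sgn(κ) · ( I_{3/4}(η) − I_{−1/4}(η) ) ), where sgn(κ) is the sign of κ. -/
open Real MeasureTheory

/-- The modified Bessel function of the first kind, `I_ν(x) = ∑_{k≥0} (x/2)^{2k+ν}/(k!·Γ(k+ν+1))`. -/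
noncomputable def besselI (ν x : ℝ) : ℝ :=
  ∑' k : ℕ, (x / 2) ^ (2 * (k : ℝ) + ν) / ((Nat.factorial k : ℝ) * Real.Gamma ((k : ℝ) + ν + 1))

theorem hasSum_pow_div_factorial (x : ℝ) :
    HasSum (fun n : ℕ => x ^ n / (n.factorial : ℝ)) (Real.exp x) := by
  rw [Real.exp_eq_exp_ℝ]
  exact NormedSpace.expSeries_div_hasSum_exp x

open PowerSeries in
/-- If the coefficients `g` of `C` satisfy the recursion of `₁F₁(ν + 1/2; 2ν + 1; -2y)`, then
`exp * C` satisfies the modified Bessel equation. -/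
theorem exp_mul_mk_coeff_rec {a : ℝ} {g : ℕ → ℝ}
    (hg : ∀ n : ℕ, (n + 1) * (n + a) * g (n + 1) = -(2 * n + a) * g n) (n : ℕ) :
    (n + 2) * (n + 1 + a) * coeff (n + 2) (exp ℝ * mk g) = coeff n (exp ℝ * mk g) := by
  set E := exp ℝ
  set C := mk g
  have hE : d⁄dX ℝ E = E := derivative_exp ℝ
  have hC : X * d⁄dX ℝ (d⁄dX ℝ C) + 2 * (X * d⁄dX ℝ C) +
      PowerSeries.C a * (d⁄dX ℝ C + C) = 0 := by
    ext m
    have h2 : (2 : ℝ⟦X⟧) = PowerSeries.C (2 : ℝ) := (map_ofNat PowerSeries.C 2).symm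
    rw [h2]
    rcases m with _ | m
    · have := hg 0
      simp only [map_add, coeff_C_mul, coeff_derivative, coeff_zero_X_mul, C, coeff_mk, map_zero]
      push_cast at this ⊢
      linear_combination this
    · have := hg (m + 1)
      simp only [map_add, coeff_C_mul, coeff_derivative, coeff_succ_X_mul, C, coeff_mk, map_zero]
      push_cast at this ⊢
      linear_combination this
  have hD : X * d⁄dX ℝ (d⁄dX ℝ (E * C)) + PowerSeries.C a * d⁄dX ℝ (E * C) = X * (E * C) := by
    simp only [Derivation.leibniz, map_add, smul_eq_mul, hE]
    linear_combination E * hC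
  have h := congrArg (coeff (n + 1)) hD
  simp only [map_add, coeff_succ_X_mul, coeff_derivative, coeff_C_mul] at h
  push_cast at h
  linear_combination h

open PowerSeries in
theorem coeff_one_exp_mul_mk {a : ℝ} {g : ℕ → ℝ} (ha : a ≠ 0)
    (hg : ∀ n : ℕ, (n + 1) * (n + a) * g (n + 1) = -(2 * n + a) * g n) :
    coeff 1 (exp ℝ * mk g) = 0 := by
  have h := hg 0
  have : g 1 = -g 0 := by
    apply mul_left_cancel₀ ha
    simp at h
    linear_combination h
  simp [coeff_mul, Finset.Nat.antidiagonal_succ, this]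

theorem summable_norm_of_hypergeometric_rec {a : ℝ} {g : ℕ → ℝ} (ha : ∀ n : ℕ, (n : ℝ) + a ≠ 0)
    (hg : ∀ n : ℕ, (n + 1) * (n + a) * g (n + 1) = -(2 * n + a) * g n) (y : ℝ) :
    Summable fun n => ‖g n * y ^ n‖ := by
  apply summable_of_ratio_norm_eventually_le (r := 1 / 2) (by norm_num)
  obtain ⟨N, hN⟩ := exists_nat_ge (2 * |a| + 12 * |y|)
  filter_upwards [Filter.eventually_ge_atTop N] with n hn
  have hn' : 2 * |a| + 12 * |y| ≤ n := hN.trans (by exact_mod_cast hn)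
  have hy := abs_nonneg y
  have ha1 := neg_abs_le a
  have ha2 := le_abs_self a
  have hrec := congrArg abs (hg n)
  rw [abs_mul, abs_mul, abs_mul, abs_neg, abs_of_pos (by positivity : (0 : ℝ) < n + 1),
    abs_of_nonneg (by linarith : (0 : ℝ) ≤ n + a),
    abs_of_nonneg (by linarith : (0 : ℝ) ≤ 2 * n + a)] at hrec
  have hpos : 0 < (n : ℝ) + a := lt_of_le_of_ne (by linarith) (ha n).symm
  have h1 : (n + 1) * |g (n + 1)| ≤ 6 * |g n| := by
    apply le_of_mul_le_mul_left _ hpos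
    have : 0 ≤ |g n| * (4 * n + 5 * a) := mul_nonneg (abs_nonneg _) (by linarith)
    linarith
  have h2 : |g (n + 1)| * |y| ≤ 1 / 2 * |g n| := by
    have hn1 : (0 : ℝ) < n + 1 := by positivity
    apply le_of_mul_le_mul_left _ hn1
    have h3 := mul_le_mul_of_nonneg_right h1 hy
    have h4 : |g n| * (12 * |y|) ≤ |g n| * (n + 1) :=
      mul_le_mul_of_nonneg_left (by linarith [abs_nonneg a]) (abs_nonneg _)
    linarith
  simp only [norm_mul, norm_pow, Real.norm_eq_abs, abs_abs]
  have := mul_le_mul_of_nonneg_right h2 (by positivity : 0 ≤ |y| ^ n)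
  rw [pow_succ]
  linarith

open PowerSeries in
/-- Kummer's second formula, in the form `e^{-y} I_ν(y) = (y/2)^ν / Γ(ν+1) · ∑ g_n y^n`, where
`g` is given by its recursion. -/
theorem hasSum_exp_neg_mul_besselI {ν y : ℝ} (hy : 0 < y) {g : ℕ → ℝ} (h0 : g 0 = 1)
    (hν : ∀ n : ℕ, (n : ℝ) + (2 * ν + 1) ≠ 0)
    (hg : ∀ n : ℕ, (n + 1) * (n + (2 * ν + 1)) * g (n + 1) = -(2 * n + (2 * ν + 1)) * g n) :
    HasSum (fun n => (y / 2) ^ ν / Real.Gamma (ν + 1) * (g n * y ^ n))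
      (Real.exp (-y) * besselI ν y) := by
  have hgs := summable_norm_of_hypergeometric_rec hν hg y
  have hexp := hasSum_pow_div_factorial y
  have hes : Summable fun n : ℕ => ‖y ^ n / (n.factorial : ℝ)‖ := by
    simpa [abs_of_pos hy] using hexp.summable
  set d : ℕ → ℝ := fun n => coeff n (exp ℝ * mk g)
  have hconv : ∀ n, ∑ kl ∈ Finset.HasAntidiagonal.antidiagonal n,
      y ^ kl.1 / (kl.1.factorial : ℝ) * (g kl.2 * y ^ kl.2) = d n * y ^ n := by
    intro n
    simp only [d, coeff_mul, Finset.sum_mul]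
    refine Finset.sum_congr rfl fun kl hkl => ?_
    rw [← Finset.HasAntidiagonal.mem_antidiagonal.mp hkl, pow_add]
    simp [coeff_exp]
    ring
  have hds : Summable fun n => d n * y ^ n := by
    have := (summable_norm_sum_mul_antidiagonal_of_summable_norm hes hgs).of_norm
    simpa only [hconv] using this
  have hprod : Real.exp y * ∑' n, g n * y ^ n = ∑' n, d n * y ^ n := by
    have := tsum_mul_tsum_eq_tsum_sum_antidiagonal_of_summable_norm hes hgs
    simpa only [hconv, hexp.tsum_eq] using this
  have hdrec : ∀ n : ℕ, ((n : ℝ) + 2) * (n + 1 + (2 * ν + 1)) * d (n + 2) = d n :=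
    exp_mul_mk_coeff_rec hg
  have hodd : ∀ k : ℕ, d (2 * k + 1) = 0 := by
    intro k
    induction k with
    | zero => exact coeff_one_exp_mul_mk (by simpa using hν 0) hg
    | succ k ih =>
      have h := hdrec (2 * k + 1)
      rw [ih] at h
      have h2 := hν (2 * k + 1 + 1)
      push_cast at h h2
      have h3 : (2 * (k : ℝ) + 1 + 2) ≠ 0 := by positivity
      simpa [h2, h3, show 2 * k + 1 + 2 = 2 * (k + 1) + 1 by ring] using h
  have hΓ0 : Real.Gamma (ν + 1) ≠ 0 := by
    refine Real.Gamma_ne_zero fun m hm => hν (2 * m + 1) ?_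
    push_cast
    linarith
  have hΓ : ∀ k : ℕ, Real.Gamma (k + ν + 1) ≠ 0 := by
    intro k
    refine Real.Gamma_ne_zero fun m hm => hν (2 * (m + k) + 1) ?_
    push_cast
    linarith
  have heven : ∀ k : ℕ, d (2 * k) =
      Real.Gamma (ν + 1) / (4 ^ k * k.factorial * Real.Gamma (k + ν + 1)) := by
    intro k
    induction k with
    | zero =>
      simp [d, h0, hΓ0]
    | succ k ih =>
      have h := hdrec (2 * k)
      have hs : (k : ℝ) + ν + 1 ≠ 0 := by
        intro hk
        apply hν (2 * k + 1)
        push_cast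
        linarith
      rw [ih] at h
      have e1 : ((k + 1 : ℕ) : ℝ) + ν + 1 = (k + ν + 1) + 1 := by push_cast; ring
      rw [e1, Real.Gamma_add_one hs, Nat.factorial_succ, show 2 * (k + 1) = 2 * k + 2 by ring]
      have h3 : (2 * (k : ℝ) + 2) * (2 * k + 1 + (2 * ν + 1)) ≠ 0 := by
        rw [show (2 * (k : ℝ) + 2) * (2 * k + 1 + (2 * ν + 1)) =
          4 * (k + 1) * (k + ν + 1) by ring]
        positivity
      push_cast at h ⊢
      apply mul_left_cancel₀ h3
      rw [h]
      have := hΓ k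
      field_simp
      ring
  have hfun : (∑' n, d n * y ^ n) = ∑' k : ℕ, d (2 * k) * y ^ (2 * k) := by
    have he : Function.Injective fun k : ℕ => 2 * k := fun a b h => by simpa using h
    refine (he.tsum_eq (f := fun n => d n * y ^ n) fun n hn => ?_).symm
    rcases Nat.even_or_odd' n with ⟨k, rfl | rfl⟩
    · exact ⟨k, rfl⟩
    · simp [hodd] at hn
  have hbessel : besselI ν y =
      (y / 2) ^ ν / Real.Gamma (ν + 1) * ∑' k : ℕ, d (2 * k) * y ^ (2 * k) := by
    rw [besselI, ← tsum_mul_left]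
    congr 1 with k
    rw [heven, Real.rpow_add (by positivity), show 2 * (k : ℝ) = ((2 * k : ℕ) : ℝ) by push_cast; rfl,
      Real.rpow_natCast, div_pow, pow_mul (2 : ℝ)]
    have := hΓ k
    norm_num
    field_simp
  have : Real.exp (-y) * besselI ν y =
      (y / 2) ^ ν / Real.Gamma (ν + 1) * ∑' n, g n * y ^ n := by
    rw [hbessel, ← hfun, ← hprod, Real.exp_neg]
    field_simp
  rw [this]
  exact hgs.of_norm.hasSum.mul_left _

/-- Termwise integration of an exponential-type power series against a Gaussian weight. -/
theorem hasSum_gaussian_moments {s κ : ℝ} (hs : -1 < s) {ε : ℕ → ℝ} (hε : ∀ n, |ε n| ≤ 1)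
    {f : ℝ → ℝ} (hf : ∀ x, HasSum (fun n : ℕ => ε n * x ^ n / n.factorial) (f x)) :
    HasSum (fun n : ℕ => ε n * κ ^ n / n.factorial * (Real.Gamma ((n + s + 1) / 2) / 2))
      (∫ z in Set.Ioi (0 : ℝ), Real.exp (-z ^ 2) * z ^ s * f (z * κ)) := by
  have hmeas : ∀ r : ℝ, Measurable fun z : ℝ => z ^ r := fun r => measurable_id.pow_const r
  have key := MeasureTheory.hasSum_integral_of_dominated_convergence
    (μ := volume.restrict (Set.Ioi (0 : ℝ)))
    (F := fun n z => Real.exp (-z ^ 2) * z ^ s * (ε n * (z * κ) ^ n / n.factorial))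
    (f := fun z => Real.exp (-z ^ 2) * z ^ s * f (z * κ))
    (fun n z => Real.exp (-z ^ 2) * z ^ s * (|z * κ| ^ n / n.factorial))
    ?_ ?_ ?_ ?_ ?_
  · convert! key using 1
    funext n
    have h := integral_rpow_mul_exp_neg_rpow (p := 2) (q := n + s) two_pos
      (by linarith [(Nat.cast_nonneg n : (0 : ℝ) ≤ n)])
    rw [show Real.Gamma ((n + s + 1) / 2) / 2 = 1 / 2 * Real.Gamma ((n + s + 1) / 2) by ring,
      ← h, ← integral_const_mul]
    refine setIntegral_congr_fun measurableSet_Ioi fun z hz => ?_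
    have hz : 0 < z := hz
    simp only [Real.rpow_add hz, Real.rpow_natCast, Real.rpow_two, mul_pow]
    ring
  · intro n
    have := hmeas s
    exact Measurable.aestronglyMeasurable (by fun_prop)
  · intro n
    refine (ae_restrict_iff' measurableSet_Ioi).mpr (Filter.Eventually.of_forall fun z hz => ?_)
    have hz : 0 < z := hz
    rw [norm_mul, Real.norm_of_nonneg (by positivity)]
    refine mul_le_mul_of_nonneg_left ?_ (by positivity)
    rw [Real.norm_eq_abs, abs_div, abs_mul, abs_pow, Nat.abs_cast]
    gcongr
    exact mul_le_of_le_one_left (by positivity) (hε n)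
  · exact Filter.Eventually.of_forall fun z => (hasSum_pow_div_factorial _).summable.mul_left _
  · simp only [tsum_mul_left, (hasSum_pow_div_factorial _).tsum_eq]
    have hint : IntegrableOn (fun z : ℝ => Real.exp (κ ^ 2 / 2) *
        (z ^ s * Real.exp (-(1 / 2) * z ^ 2))) (Set.Ioi 0) :=
      (integrableOn_rpow_mul_exp_neg_mul_sq (by norm_num) hs).const_mul _
    refine Integrable.mono' hint ?_ ?_
    · have := hmeas s
      exact Measurable.aestronglyMeasurable (by fun_prop)
    · refine (ae_restrict_iff' measurableSet_Ioi).mpr (Filter.Eventually.of_forall fun z hz => ?_)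
      have hz : 0 < z := hz
      rw [Real.norm_of_nonneg (by positivity)]
      have h1 : Real.exp (-z ^ 2) * Real.exp |z * κ| ≤
          Real.exp (κ ^ 2 / 2) * Real.exp (-(1 / 2) * z ^ 2) := by
        rw [← Real.exp_add, ← Real.exp_add, Real.exp_le_exp]
        have : |z * κ| ≤ z ^ 2 / 2 + κ ^ 2 / 2 :=
          abs_le.mpr ⟨by nlinarith [sq_nonneg (z + κ)], by nlinarith [sq_nonneg (z - κ)]⟩
        linarith
      have := mul_le_mul_of_nonneg_left h1 (Real.rpow_nonneg hz.le s)
      linarith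
  · exact Filter.Eventually.of_forall fun z => (hf _).mul_left _

theorem hasSum_exp_neg_mul_besselI_sub_even {y : ℝ} (hy : 0 < y) {G : ℕ → ℝ} (h0 : G 0 = 1)
    (hG : ∀ n : ℕ, (n + 1) * (2 * n + 1) * G (n + 1) = -(4 * n + 3) * G n) :
    HasSum (fun n => (y / 2) ^ (-(3 / 4) : ℝ) / Real.Gamma (1 / 4) * (G n * y ^ n))
      (Real.exp (-y) * (besselI (-(3 / 4)) y - besselI (1 / 4) y)) := by
  have hne : ∀ n : ℕ, 4 * (n : ℝ) - 1 ≠ 0 := fun n => by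
    have : 4 * (n : ℤ) - 1 ≠ 0 := by omega
    exact_mod_cast this
  have hne' : ∀ n : ℕ, 2 * (n : ℝ) - 1 ≠ 0 := fun n => by
    have : 2 * (n : ℤ) - 1 ≠ 0 := by omega
    exact_mod_cast this
  have hG' : ∀ n : ℕ, G (n + 1) = -(4 * n + 3) * G n / ((n + 1) * (2 * n + 1)) := fun n => by
    rw [← hG]
    field_simp
  have hsucc : ∀ n : ℕ, 4 * ((n : ℝ) + 1) - 1 = 4 * n + 3 := fun n => by ring
  have h1 := hasSum_exp_neg_mul_besselI (ν := -(3 / 4)) hy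
    (g := fun n => G n * (2 * n - 1) / (4 * n - 1)) (by simp [h0])
    (fun n hn => hne' n (by linarith)) (fun n => by
      have a1 := hne n
      push_cast
      rw [hG', hsucc]
      have hl : ((n : ℝ) + 1) * ((2 * n - 1) / 2) * (-(4 * n + 3) * G n /
          ((n + 1) * (2 * n + 1)) * (2 * (n + 1) - 1) / (4 * n + 3)) =
            -(1 / 2) * (G n * (2 * n - 1)) := by
        field_simp
        ring
      have hr : (4 * (n : ℝ) - 1) * (G n * (2 * n - 1) / (4 * n - 1)) = G n * (2 * n - 1) :=
        mul_div_cancel₀ _ a1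
      linear_combination hl + 1 / 2 * hr)
  have h2 := hasSum_exp_neg_mul_besselI (ν := 1 / 4) hy
    (g := fun n => G n / (2 * n + 1)) (by simp [h0]) (fun n => by positivity) (fun n => by
      push_cast
      rw [hG']
      field_simp
      ring)
  have hpref : (y / 2) ^ (1 / 4 : ℝ) / Real.Gamma (1 / 4 + 1) =
      (y / 2) ^ (-(3 / 4) : ℝ) / Real.Gamma (1 / 4) * (2 * y) := by
    rw [Real.Gamma_add_one (by norm_num), show (1 / 4 : ℝ) = -(3 / 4) + 1 by norm_num,
      Real.rpow_add_one (by positivity)]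
    field_simp
    norm_num
  have h3 : HasSum (fun n : ℕ => (y / 2) ^ (-(3 / 4) : ℝ) / Real.Gamma (1 / 4) *
      (-(G n * (2 * n) / (4 * n - 1)) * y ^ n)) (Real.exp (-y) * besselI (1 / 4) y) := by
    rw [← hasSum_nat_add_iff' 1]
    convert! h2 using 1
    · funext n
      rw [hpref, mul_assoc]
      congr 1
      push_cast
      rw [pow_succ, hG', hsucc]
      field_simp
    · simp
  rw [mul_sub]
  convert! h1.sub h3 using 1
  funext n
  rw [show (-(3 / 4) + 1 : ℝ) = 1 / 4 by norm_num]
  have := hne n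
  field_simp
  ring

theorem hasSum_exp_neg_mul_besselI_sub_odd {y : ℝ} (hy : 0 < y) {H : ℕ → ℝ} (h0 : H 0 = 1)
    (hH : ∀ n : ℕ, (n + 1) * (2 * n + 3) * H (n + 1) = -(4 * n + 5) * H n) :
    HasSum (fun n => (y / 2) ^ (-(1 / 4) : ℝ) / Real.Gamma (3 / 4) * (H n * y ^ n))
      (Real.exp (-y) * (besselI (-(1 / 4)) y - besselI (3 / 4) y)) := by
  have hH' : ∀ n : ℕ, H (n + 1) = -(4 * n + 5) * H n / ((n + 1) * (2 * n + 3)) := fun n => by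
    rw [← hH]
    field_simp
  have h1 := hasSum_exp_neg_mul_besselI (ν := -(1 / 4)) hy
    (g := fun n => H n * (2 * n + 1) / (4 * n + 1)) (by simp [h0])
    (fun n => by
      have : (0 : ℝ) < n + 1 / 2 := by positivity
      linarith) (fun n => by
      push_cast
      rw [hH']
      field_simp
      ring)
  have h2 := hasSum_exp_neg_mul_besselI (ν := 3 / 4) hy
    (g := fun n => 3 * H n / (2 * n + 3)) (by simp [h0]) (fun n => by positivity) (fun n => by
      push_cast
      rw [hH']
      field_simp
      ring)
  have hpref : (y / 2) ^ (3 / 4 : ℝ) / Real.Gamma (3 / 4 + 1) =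
      (y / 2) ^ (-(1 / 4) : ℝ) / Real.Gamma (3 / 4) * (2 * y / 3) := by
    rw [Real.Gamma_add_one (by norm_num), show (3 / 4 : ℝ) = -(1 / 4) + 1 by norm_num,
      Real.rpow_add_one (by positivity)]
    field_simp
    norm_num
  have h3 : HasSum (fun n : ℕ => (y / 2) ^ (-(1 / 4) : ℝ) / Real.Gamma (3 / 4) *
      (-(H n * (2 * n) / (4 * n + 1)) * y ^ n)) (Real.exp (-y) * besselI (3 / 4) y) := by
    rw [← hasSum_nat_add_iff' 1]
    convert! h2 using 1
    · funext n
      rw [hpref, mul_assoc]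
      congr 1
      push_cast
      rw [pow_succ, hH']
      field_simp
      ring
    · simp
  rw [mul_sub]
  convert! h1.sub h3 using 1
  funext n
  rw [show (-(1 / 4) + 1 : ℝ) = 3 / 4 by norm_num]
  field_simp
  ring

theorem Gamma_one_quarter_mul_Gamma_three_quarters :
    Real.Gamma (1 / 4) * Real.Gamma (3 / 4) = π * √2 := by
  have h := Real.Gamma_mul_Gamma_one_sub (1 / 4)
  rw [show (1 - 1 / 4 : ℝ) = 3 / 4 by norm_num, show π * (1 / 4) = π / 4 by ring,
    Real.sin_pi_div_four] at h
  rw [h]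
  have : √2 * √2 = 2 := Real.mul_self_sqrt (by norm_num)
  field_simp
  linear_combination -this

theorem hasSum_cos_add_sin (x : ℝ) :
    HasSum (fun n : ℕ => (-1 : ℝ) ^ (n / 2) * x ^ n / n.factorial)
      (Real.cos x + Real.sin x) := by
  refine HasSum.even_add_odd ?_ ?_
  · convert Real.hasSum_cos x using 4 with n
    simp
  · convert Real.hasSum_sin x using 4 with n
    congr 1
    omega

theorem hasSum_even_moments {κ : ℝ} (hκ : κ ≠ 0) :
    HasSum (fun n : ℕ => (-1 : ℝ) ^ n * κ ^ (2 * n) / (2 * n).factorial *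
        (Real.Gamma (n + 3 / 4) / 2))
      (√2 * (π / 16 * |κ| ^ (3 / 2 : ℝ) * (Real.exp (-(κ ^ 2 / 8)) *
        (besselI (-(3 / 4)) (κ ^ 2 / 8) - besselI (1 / 4) (κ ^ 2 / 8))))) := by
  have hy : 0 < κ ^ 2 / 8 := by positivity
  have hΓ : Real.Gamma (3 / 4) ≠ 0 := (Real.Gamma_pos_of_pos (by norm_num)).ne'
  have hΓ' : Real.Gamma (1 / 4) ≠ 0 := (Real.Gamma_pos_of_pos (by norm_num)).ne'
  have key := hasSum_exp_neg_mul_besselI_sub_even hy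
    (G := fun n => (-8) ^ n * Real.Gamma (n + 3 / 4) / (Real.Gamma (3 / 4) * (2 * n).factorial))
    (by simp [hΓ]) (fun n => by
      rw [show 2 * (n + 1) = 2 * n + 1 + 1 by ring, Nat.factorial_succ, Nat.factorial_succ,
        show ((n + 1 : ℕ) : ℝ) + 3 / 4 = (n + 3 / 4) + 1 by push_cast; ring,
        Real.Gamma_add_one (by positivity)]
      push_cast
      field_simp
      ring)
  have hpow : |κ| ^ (3 / 2 : ℝ) * (κ ^ 2 / 8 / 2) ^ (-(3 / 4) : ℝ) = 8 := by
    have hk : 0 < |κ| := abs_pos.mpr hκ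
    have h16 : (16 : ℝ) ^ (-(3 / 4) : ℝ) = 8⁻¹ := by
      rw [show (16 : ℝ) = 2 ^ (4 : ℝ) by norm_num, ← Real.rpow_mul (by norm_num)]
      norm_num
    rw [← sq_abs, div_div, Real.div_rpow (by positivity) (by norm_num), ← Real.rpow_natCast |κ| 2,
      ← Real.rpow_mul hk.le, ← mul_div_assoc, ← Real.rpow_add hk]
    norm_num [h16]
  convert! key.mul_left (√2 * (π / 16 * |κ| ^ (3 / 2 : ℝ))) using 1
  · funext n
    have e : √2 * (π / 16 * |κ| ^ (3 / 2 : ℝ)) *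
        ((κ ^ 2 / 8 / 2) ^ (-(3 / 4) : ℝ) / Real.Gamma (1 / 4)) = Real.Gamma (3 / 4) / 2 := by
      generalize (κ ^ 2 / 8 / 2) ^ (-(3 / 4) : ℝ) = w at hpow ⊢
      field_simp
      linear_combination 2 * (√2 * π) * hpow - 16 * Gamma_one_quarter_mul_Gamma_three_quarters
    rw [← mul_assoc, e, show (-8 : ℝ) ^ n = (-1) ^ n * 8 ^ n by rw [← mul_pow]; norm_num,
      div_pow, pow_mul]
    field_simp
  · ring

theorem hasSum_odd_moments {κ : ℝ} (hκ : κ ≠ 0) :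
    HasSum (fun n : ℕ => (-1 : ℝ) ^ n * κ ^ (2 * n + 1) / (2 * n + 1).factorial *
        (Real.Gamma (n + 5 / 4) / 2))
      (√2 * (π / 16 * |κ| ^ (3 / 2 : ℝ) * Real.sign κ * (Real.exp (-(κ ^ 2 / 8)) *
        (besselI (-(1 / 4)) (κ ^ 2 / 8) - besselI (3 / 4) (κ ^ 2 / 8))))) := by
  have hy : 0 < κ ^ 2 / 8 := by positivity
  have hΓ : Real.Gamma (3 / 4) ≠ 0 := (Real.Gamma_pos_of_pos (by norm_num)).ne'
  have hΓ' : Real.Gamma (5 / 4) ≠ 0 := (Real.Gamma_pos_of_pos (by norm_num)).ne'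
  have h54 : Real.Gamma (5 / 4) = 1 / 4 * Real.Gamma (1 / 4) := by
    rw [← Real.Gamma_add_one (by norm_num)]
    norm_num
  have key := hasSum_exp_neg_mul_besselI_sub_odd hy
    (H := fun n => (-8) ^ n * Real.Gamma (n + 5 / 4) /
      (Real.Gamma (5 / 4) * (2 * n + 1).factorial))
    (by simp [hΓ']) (fun n => by
      rw [show 2 * (n + 1) + 1 = 2 * n + 1 + 1 + 1 by ring, Nat.factorial_succ (2 * n + 1 + 1),
        Nat.factorial_succ (2 * n + 1),
        show ((n + 1 : ℕ) : ℝ) + 5 / 4 = (n + 5 / 4) + 1 by push_cast; ring,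
        Real.Gamma_add_one (by positivity)]
      push_cast
      field_simp
      ring)
  have hpow : |κ| ^ (3 / 2 : ℝ) * Real.sign κ * (κ ^ 2 / 8 / 2) ^ (-(1 / 4) : ℝ) = 2 * κ := by
    have hk : 0 < |κ| := abs_pos.mpr hκ
    have h16 : (16 : ℝ) ^ (-(1 / 4) : ℝ) = 2⁻¹ := by
      rw [show (16 : ℝ) = 2 ^ (4 : ℝ) by norm_num, ← Real.rpow_mul (by norm_num)]
      norm_num [Real.rpow_neg_one]
    have hs : Real.sign κ * |κ| = κ := by
      rcases lt_or_gt_of_ne hκ with h | h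
      · simp [Real.sign_of_neg h, abs_of_neg h]
      · simp [Real.sign_of_pos h, abs_of_pos h]
    have hp : |κ| ^ (3 / 2 : ℝ) * (κ ^ 2 / 8 / 2) ^ (-(1 / 4) : ℝ) = 2 * |κ| := by
      rw [← sq_abs, div_div, Real.div_rpow (by positivity) (by norm_num),
        ← Real.rpow_natCast |κ| 2, ← Real.rpow_mul hk.le, ← mul_div_assoc, ← Real.rpow_add hk]
      norm_num [h16]
      ring
    linear_combination Real.sign κ * hp + 2 * hs
  convert! key.mul_left (√2 * (π / 16 * |κ| ^ (3 / 2 : ℝ) * Real.sign κ)) using 1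
  · funext n
    have e : √2 * (π / 16 * |κ| ^ (3 / 2 : ℝ) * Real.sign κ) *
        ((κ ^ 2 / 8 / 2) ^ (-(1 / 4) : ℝ) / Real.Gamma (3 / 4)) =
          κ * Real.Gamma (5 / 4) / 2 := by
      rw [h54]
      generalize (κ ^ 2 / 8 / 2) ^ (-(1 / 4) : ℝ) = w at hpow ⊢
      field_simp
      linear_combination 8 * (√2 * π) * hpow - 16 * κ * Gamma_one_quarter_mul_Gamma_three_quarters
    rw [← mul_assoc, e, show (-8 : ℝ) ^ n = (-1) ^ n * 8 ^ n by rw [← mul_pow]; norm_num,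
      div_pow, pow_succ, pow_mul]
    field_simp
  · ring

/-- The profile function `Φ₂(κ) = ∫_0^∞ e^{−z²} z^{1/2} sin(zκ + π/4) dz` expressed through
modified Bessel functions, with `η = κ²/8`. -/
theorem phi2_bessel_formula (κ : ℝ) (hκ : κ ≠ 0) :
    ∫ z in Set.Ioi (0 : ℝ), Real.exp (-z ^ 2) * z ^ ((1 : ℝ) / 2) * Real.sin (z * κ + π / 4) =
      (π / 16) * Real.exp (-(κ ^ 2 / 8)) * |κ| ^ ((3 : ℝ) / 2) *
        (besselI (-(3 / 4)) (κ ^ 2 / 8) - besselI (1 / 4) (κ ^ 2 / 8) -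
          Real.sign κ * (besselI (3 / 4) (κ ^ 2 / 8) - besselI (-(1 / 4)) (κ ^ 2 / 8))) := by
  have hI := hasSum_gaussian_moments (s := 1 / 2) (κ := κ) (by norm_num)
    (ε := fun n => (-1) ^ (n / 2)) (fun n => by simp) hasSum_cos_add_sin
  have hS := HasSum.even_add_odd
    (f := fun n : ℕ => (-1 : ℝ) ^ (n / 2) * κ ^ n / n.factorial *
      (Real.Gamma ((n + 1 / 2 + 1) / 2) / 2))
    (by
      convert! hasSum_even_moments hκ using 1
      funext n
      rw [show 2 * n / 2 = n by omega,
        show (((2 * n : ℕ) : ℝ) + 1 / 2 + 1) / 2 = n + 3 / 4 by push_cast; ring])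
    (by
      convert! hasSum_odd_moments hκ using 1
      funext n
      rw [show (2 * n + 1) / 2 = n by omega,
        show (((2 * n + 1 : ℕ) : ℝ) + 1 / 2 + 1) / 2 = n + 5 / 4 by push_cast; ring])
  have hsin : ∀ z : ℝ, Real.exp (-z ^ 2) * z ^ ((1 : ℝ) / 2) * Real.sin (z * κ + π / 4) =
      √2 / 2 * (Real.exp (-z ^ 2) * z ^ ((1 : ℝ) / 2) *
        (Real.cos (z * κ) + Real.sin (z * κ))) := fun z => by
    rw [Real.sin_add, Real.sin_pi_div_four, Real.cos_pi_div_four]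
    ring
  simp only [hsin]
  rw [integral_const_mul, hI.unique hS]
  have h2 : √2 * √2 = 2 := Real.mul_self_sqrt (by norm_num)
  linear_combination (π / 16 * Real.exp (-(κ ^ 2 / 8)) * |κ| ^ ((3 : ℝ) / 2) *
    (besselI (-(3 / 4)) (κ ^ 2 / 8) - besselI (1 / 4) (κ ^ 2 / 8) -
      Real.sign κ * (besselI (3 / 4) (κ ^ 2 / 8) - besselI (-(1 / 4)) (κ ^ 2 / 8)))) / 2 * h2
end

section
/- For every real κ ≠ 0, with η = κ²/8, one has ∫_0^∞ e^{−z²} z^{3/2} sin(zκ − π/4) dz = (π/32) · e^{−η} · |κ|^{1/2} · ( (κ² − 2)·I_{−1/4}(η) − κ²·I_{3/4}(η) − sgn(κ)·( (κ² − 2)·I_{1/4}(η) − κ²·I_{−3/4}(η) ) ), where sgn(κ) is the sign of κ. -/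
open Real MeasureTheory

open PowerSeries in
/-- A power series solution of `x p'' + c p' = x p` satisfies a two-step recursion. -/
theorem coeff_recursion_of_bessel_ode (c : ℝ) (p : ℝ⟦X⟧)
    (hp : X * d⁄dX ℝ (d⁄dX ℝ p) + C c * d⁄dX ℝ p = X * p) :
    c * coeff 1 p = 0 ∧
      ∀ n : ℕ, ((n : ℝ) + 2) * (n + 1 + c) * coeff (n + 2) p = coeff n p := by
  constructor
  · have h := congrArg (coeff 0) hp
    rw [map_add, coeff_zero_X_mul, coeff_zero_X_mul, coeff_C_mul, coeff_derivative] at h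
    simpa using h
  · intro n
    have h := congrArg (coeff (n + 1)) hp
    rw [map_add, coeff_succ_X_mul, coeff_succ_X_mul, coeff_C_mul, coeff_derivative,
      coeff_derivative] at h
    push_cast at h
    rw [← h]
    ring

open PowerSeries in
/-- Multiplication by `exp` turns a solution of Kummer's equation (with argument `-2x` and
`b = 2a = c`) into a solution of Bessel's modified equation. -/
theorem bessel_ode_exp_mul (c : ℝ) (m : ℕ → ℝ)
    (hm : ∀ n : ℕ, ((n : ℝ) + 1) * (n + c) * m (n + 1) = -(2 * n + c) * m n) :
    X * d⁄dX ℝ (d⁄dX ℝ (exp ℝ * mk m)) + C c * d⁄dX ℝ (exp ℝ * mk m) = X * (exp ℝ * mk m) := by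
  have hM : X * d⁄dX ℝ (d⁄dX ℝ (mk m)) + (C c + 2 * X) * d⁄dX ℝ (mk m) + C c * mk m = 0 := by
    ext n
    rw [add_mul, mul_assoc, show (2 : ℝ⟦X⟧) = C 2 from (map_ofNat C 2).symm]
    cases n with
    | zero =>
      have h := hm 0
      simp only [map_add, coeff_C_mul, coeff_zero_X_mul, coeff_derivative, coeff_mk, map_zero]
      push_cast at h ⊢
      linarith
    | succ n =>
      have h := hm (n + 1)
      simp only [map_add, coeff_C_mul, coeff_succ_X_mul, coeff_derivative, coeff_mk, map_zero]
      push_cast at h ⊢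
      linarith
  simp only [Derivation.leibniz, map_add, smul_eq_mul, derivative_exp]
  linear_combination exp ℝ * hM

/-- The Taylor coefficients of the Kummer function `(Γ(a) / Γ(b)) ₁F₁(a; b; x)`. -/
noncomputable def kummerCoeff (a b : ℝ) (n : ℕ) : ℝ :=
  Gamma (n + a) / (Gamma (n + b) * n.factorial)

theorem kummerCoeff_succ {a b : ℝ} {n : ℕ} (ha : (n : ℝ) + a ≠ 0) (hb : (n : ℝ) + b ≠ 0) :
    kummerCoeff a b (n + 1) = (n + a) / ((n + b) * (n + 1)) * kummerCoeff a b n := by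
  unfold kummerCoeff
  push_cast [Nat.factorial_succ]
  rw [add_right_comm (n : ℝ) 1 a, add_right_comm (n : ℝ) 1 b, Gamma_add_one ha, Gamma_add_one hb]
  have : (n : ℝ) + 1 ≠ 0 := by positivity
  simp only [div_eq_mul_inv, mul_inv]
  ring

open Filter Topology in
theorem summable_norm_kummerCoeff_mul_pow (a b x : ℝ) :
    Summable fun n : ℕ => ‖kummerCoeff a b n * x ^ n‖ := by
  rcases eq_or_ne x 0 with rfl | hx
  · refine summable_of_ne_finset_zero (s := {0}) fun n hn => ?_
    simp at hn
    simp [hn]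
  have hA : ∀ c : ℝ, ∀ᶠ n : ℕ in atTop, 0 < (n : ℝ) + c := fun c =>
    (tendsto_natCast_atTop_atTop.atTop_add tendsto_const_nhds).eventually_gt_atTop 0
  have hlim : Tendsto (fun n : ℕ => ‖((n : ℝ) + a) / ((n + b) * (n + 1)) * x‖) atTop (𝓝 0) := by
    have h1 : Tendsto (fun n : ℕ => ((n : ℝ) + a) / (n + b)) atTop (𝓝 1) := by
      have := (tendsto_add_mul_div_add_mul_atTop_nhds a b (1 : ℝ) (one_ne_zero (α := ℝ)))
      simpa [add_comm] using this
    have h2 : Tendsto (fun n : ℕ => 1 / ((n : ℝ) + 1)) atTop (𝓝 0) :=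
      tendsto_one_div_add_atTop_nhds_zero_nat
    have := ((h1.mul h2).mul_const x).norm
    simp only [mul_zero, zero_mul, norm_zero] at this
    refine this.congr fun n => ?_
    rw [div_mul_div_comm, mul_one]
  refine (summable_of_ratio_test_tendsto_lt_one zero_lt_one (l := 0) ?_ ?_)
  · filter_upwards [hA a, hA b] with n h1 h2
    rw [norm_ne_zero_iff]
    unfold kummerCoeff
    have := Gamma_pos_of_pos h1
    have := Gamma_pos_of_pos h2
    positivity
  · refine hlim.congr' ?_
    filter_upwards [hA a, hA b] with n h1 h2
    have h3 : kummerCoeff a b n * x ^ n ≠ 0 := by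
      unfold kummerCoeff
      have := Gamma_pos_of_pos h1
      have := Gamma_pos_of_pos h2
      positivity
    rw [norm_norm, norm_norm, ← norm_div, kummerCoeff_succ h1.ne' h2.ne', pow_succ]
    congr 1
    have := left_ne_zero_of_mul h3
    field_simp

theorem exp_mul_tsum_kummerCoeff {ν : ℝ} (hν : ∀ n : ℕ, (n : ℝ) + (2 * ν + 1) ≠ 0) {x : ℝ}
    (hx : 0 < x) :
    Real.exp x * ∑' n : ℕ, kummerCoeff (ν + 1 / 2) (2 * ν + 1) n * (-2 * x) ^ n =
      √π * (2 * x) ^ (-ν) * besselI ν x := by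
  set m : ℕ → ℝ := fun n => kummerCoeff (ν + 1 / 2) (2 * ν + 1) n * (-2) ^ n with hm
  have ha : ∀ n : ℕ, (n : ℝ) + (ν + 1 / 2) ≠ 0 := fun n h => hν (2 * n) (by push_cast; linarith)
  have hc : ∀ n : ℕ, (n : ℝ) + (ν + 1) ≠ 0 := fun n h => hν (2 * n + 1) (by push_cast; linarith)
  obtain ⟨p1, p2⟩ := coeff_recursion_of_bessel_ode _ _ (bessel_ode_exp_mul (2 * ν + 1) m fun n => by
    simp only [hm]
    rw [kummerCoeff_succ (ha n) (hν n), pow_succ]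
    have := hν n
    field_simp)
  set p := PowerSeries.exp ℝ * PowerSeries.mk m with hp
  have podd : ∀ k : ℕ, PowerSeries.coeff (2 * k + 1) p = 0 := by
    intro k
    induction k with
    | zero => simpa using (mul_eq_zero.1 p1).resolve_left (by simpa using hν 0)
    | succ k ih =>
      have h := p2 (2 * k + 1)
      rw [ih] at h
      refine (mul_eq_zero.1 h).resolve_left (mul_ne_zero (by positivity) ?_)
      have := hν (2 * k + 2)
      push_cast at this ⊢
      rwa [show (2 * (k : ℝ) + 1 + 1 + (2 * ν + 1)) = 2 * k + 2 + (2 * ν + 1) by ring]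
  have hdup : Gamma (ν + 1 / 2) * Gamma (ν + 1) = Gamma (2 * ν + 1) * 2 ^ (-(2 * ν)) * √π := by
    have := Gamma_mul_Gamma_add_half (ν + 1 / 2)
    convert this using 3 <;> ring_nf
  have hG : ∀ k : ℕ, Gamma (k + ν + 1) ≠ 0 := by
    intro k
    refine Gamma_ne_zero fun j h => hc (k + j) ?_
    push_cast
    linarith
  have hGb : Gamma (2 * ν + 1) ≠ 0 := Gamma_ne_zero fun j h => hν j (by linarith)
  have peven : ∀ k : ℕ, PowerSeries.coeff (2 * k) p =
      2 ^ (-(2 * ν)) * √π / (4 ^ k * k.factorial * Gamma (k + ν + 1)) := by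
    intro k
    induction k with
    | zero =>
      have h0 := hG 0
      have : PowerSeries.coeff 0 p = m 0 := by
        simp [hp, PowerSeries.coeff_zero_eq_constantCoeff]
      simp only [mul_zero, this, hm, kummerCoeff]
      simp only [Nat.cast_zero, zero_add, Nat.factorial_zero, Nat.cast_one, mul_one, pow_zero,
        one_mul] at h0 ⊢
      rw [div_eq_div_iff hGb h0, hdup]
      ring
    | succ k ih =>
      have h := p2 (2 * k)
      have h1 : (k : ℝ) + ν + 1 ≠ 0 := by rw [add_assoc]; exact hc k
      have h2 := hG k
      rw [ih] at h
      have h3 : (k : ℝ) + 1 ≠ 0 := by positivity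
      rw [show 2 * (k + 1) = 2 * k + 2 by ring]
      push_cast [Nat.factorial_succ] at h ⊢
      rw [show (k : ℝ) + 1 + ν + 1 = k + ν + 1 + 1 by ring, Gamma_add_one h1]
      have h4 : (4 : ℝ) * (k + 1) * (k + ν + 1) * PowerSeries.coeff (2 * k + 2) p =
          2 ^ (-(2 * ν)) * √π / (4 ^ k * k.factorial * Gamma (k + ν + 1)) := by
        rw [← h]; ring
      have h5 : (k.factorial : ℝ) ≠ 0 := by positivity
      rw [eq_div_iff (by positivity)] at h4 ⊢
      rw [← h4]
      ring
  have hexp : ∀ n : ℕ, PowerSeries.coeff n (PowerSeries.exp ℝ) * x ^ n = x ^ n / n.factorial := by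
    intro n
    simp [PowerSeries.coeff_exp]
    ring
  have hse : HasSum (fun n : ℕ => PowerSeries.coeff n (PowerSeries.exp ℝ) * x ^ n)
      (Real.exp x) := by
    simp only [hexp]
    rw [Real.exp_eq_exp_ℝ]
    exact NormedSpace.expSeries_div_hasSum_exp x
  have hsm : ∀ n : ℕ, kummerCoeff (ν + 1 / 2) (2 * ν + 1) n * (-2 * x) ^ n = m n * x ^ n :=
    fun n => by simp only [hm, mul_pow]; ring
  have hsm' : Summable fun n : ℕ => ‖m n * x ^ n‖ := by
    simpa only [hsm] using
      summable_norm_kummerCoeff_mul_pow (ν + 1 / 2) (2 * ν + 1) (-2 * x)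
  have hterm : ∀ n : ℕ, ∑ kl ∈ Finset.HasAntidiagonal.antidiagonal n,
      PowerSeries.coeff kl.1 (PowerSeries.exp ℝ) * x ^ kl.1 * (m kl.2 * x ^ kl.2) =
      PowerSeries.coeff n p * x ^ n := by
    intro n
    rw [hp, PowerSeries.coeff_mul, Finset.sum_mul]
    refine Finset.sum_congr rfl fun kl hkl => ?_
    rw [← Finset.HasAntidiagonal.mem_antidiagonal.1 hkl, pow_add, PowerSeries.coeff_mk]
    ring
  rw [← hse.tsum_eq]
  simp only [hsm]
  rw [tsum_mul_tsum_eq_tsum_sum_antidiagonal_of_summable_norm hse.summable.norm hsm']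
  simp only [hterm]
  rw [besselI, ← tsum_mul_left]
  have hinj : Function.Injective fun k : ℕ => 2 * k := fun a b h => by simpa using h
  rw [← hinj.tsum_eq (f := fun n => PowerSeries.coeff n p * x ^ n)]
  · refine tsum_congr fun k => ?_
    rw [peven, rpow_add (by positivity), show (2 * (k : ℝ)) = ((2 * k : ℕ) : ℝ) by push_cast; ring,
      rpow_natCast, mul_rpow two_pos.le hx.le, div_rpow hx.le two_pos.le, rpow_neg hx.le,
      rpow_neg two_pos.le, rpow_neg two_pos.le, two_mul ν, rpow_add two_pos, div_pow,
      pow_mul 2 2 k]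
    have := hG k
    have : (0 : ℝ) < 2 ^ ν := by positivity
    have : (0 : ℝ) < x ^ ν := by positivity
    norm_num
    field_simp
  · intro n hn
    by_contra h
    rcases Nat.even_or_odd' n with ⟨k, rfl | rfl⟩
    · exact h ⟨k, rfl⟩
    · exact hn (by simp [podd])

/-- The Kummer function `(Γ(a) / Γ(b)) ₁F₁(a; b; x)`. -/
noncomputable def kummerSum (a b x : ℝ) : ℝ := ∑' n : ℕ, kummerCoeff a b n * x ^ n

theorem hasSum_kummerSum (a b x : ℝ) :
    HasSum (fun n : ℕ => kummerCoeff a b n * x ^ n) (kummerSum a b x) :=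
  (summable_norm_kummerCoeff_mul_pow a b x).of_norm.hasSum

theorem succ_mul_kummerCoeff_succ (a b : ℝ) (n : ℕ) :
    ((n : ℝ) + 1) * kummerCoeff a b (n + 1) = kummerCoeff (a + 1) (b + 1) n := by
  unfold kummerCoeff
  have h : (n : ℝ) + 1 ≠ 0 := by positivity
  push_cast [Nat.factorial_succ]
  rw [show (n : ℝ) + 1 + a = n + (a + 1) by ring, show (n : ℝ) + 1 + b = n + (b + 1) by ring,
    mul_left_comm, ← mul_div_assoc, mul_div_mul_left _ _ h]

theorem kummerCoeff_add_one_left {a : ℝ} (b : ℝ) {n : ℕ} (h : (n : ℝ) + a ≠ 0) :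
    kummerCoeff (a + 1) b n = (n + a) * kummerCoeff a b n := by
  rw [kummerCoeff, kummerCoeff, ← add_assoc, Gamma_add_one h, mul_div_assoc]

theorem kummerCoeff_eq_mul_add_one_right (a : ℝ) {b : ℝ} {n : ℕ} (h : (n : ℝ) + b ≠ 0) :
    kummerCoeff a b n = (n + b) * kummerCoeff a (b + 1) n := by
  rw [kummerCoeff, kummerCoeff, ← add_assoc, Gamma_add_one h, mul_assoc, ← mul_div_assoc,
    mul_div_mul_left _ _ h]

theorem hasSum_mul_kummerSum (a b x : ℝ) :
    HasSum (fun n : ℕ => n * kummerCoeff a b n * x ^ n) (x * kummerSum (a + 1) (b + 1) x) := by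
  rw [← hasSum_nat_add_iff' 1]
  simp only [Finset.sum_range_one, Nat.cast_zero, zero_mul, sub_zero]
  refine ((hasSum_kummerSum (a + 1) (b + 1) x).mul_left x).congr_fun fun n => ?_
  rw [← succ_mul_kummerCoeff_succ]
  push_cast
  ring

theorem hasSum_sq_mul_kummerSum (a b x : ℝ) :
    HasSum (fun n : ℕ => n * (n - 1) * kummerCoeff a b n * x ^ n)
      (x ^ 2 * kummerSum (a + 1 + 1) (b + 1 + 1) x) := by
  rw [← hasSum_nat_add_iff' 1]
  simp only [Finset.sum_range_one, Nat.cast_zero, zero_mul, sub_zero]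
  rw [sq, mul_assoc]
  refine ((hasSum_mul_kummerSum (a + 1) (b + 1) x).mul_left x).congr_fun fun n => ?_
  rw [← succ_mul_kummerCoeff_succ]
  push_cast
  ring

theorem natCast_add_quarter_ne_zero (n : ℕ) (j : ℤ) (hj : ¬ (4 : ℤ) ∣ j) :
    (n : ℝ) + j / 4 ≠ 0 := by
  intro h
  have h1 : ((4 * n + j : ℤ) : ℝ) = 0 := by push_cast; linarith
  have h2 : (4 * n + j : ℤ) = 0 := by exact_mod_cast h1
  exact hj ⟨-n, by linarith⟩

theorem kummerSum_contiguous_half (x : ℝ) :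
    (4 * x + 2) * kummerSum (1 / 4) (1 / 2) x + 4 * (x ^ 2 * kummerSum (5 / 4) (5 / 2) x) =
      8 * kummerSum (5 / 4) (1 / 2) x := by
  have h1 := hasSum_mul_kummerSum (-3 / 4) (-1 / 2) x
  have h2 := hasSum_kummerSum (1 / 4) (1 / 2) x
  have h3 := hasSum_sq_mul_kummerSum (-3 / 4) (1 / 2) x
  have h4 := hasSum_kummerSum (5 / 4) (1 / 2) x
  norm_num only at h1 h3
  have h := ((h1.mul_left 4).add (h2.mul_left 2)).add (h3.mul_left 4)
  rw [← (h.congr_fun fun n => ?_).unique (h4.mul_left 8)]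
  · ring
  have e1 := natCast_add_quarter_ne_zero n (-3) (by decide)
  have e2 := natCast_add_quarter_ne_zero n 1 (by decide)
  have e3 := natCast_add_quarter_ne_zero n (-2) (by decide)
  have k1 := kummerCoeff_add_one_left (a := -(3 / 4)) (1 / 2) (n := n)
    (by convert e1 using 2; norm_num)
  have k2 := kummerCoeff_add_one_left (a := 1 / 4) (1 / 2) (n := n)
    (by convert e2 using 2; norm_num)
  have k3 := kummerCoeff_eq_mul_add_one_right (-(3 / 4)) (b := -(1 / 2)) (n := n)
    (by convert e3 using 2; norm_num)
  norm_num only at k1 k2 k3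
  rw [k2, k1, k3]
  ring

theorem kummerSum_contiguous_three_halves (x : ℝ) :
    (4 * x + 2) * kummerSum (3 / 4) (3 / 2) x + 4 * kummerSum (-(1 / 4)) (-(1 / 2)) x =
      8 * kummerSum (7 / 4) (3 / 2) x := by
  have h1 := hasSum_mul_kummerSum (-1 / 4) (1 / 2) x
  have h2 := hasSum_kummerSum (3 / 4) (3 / 2) x
  have h3 := hasSum_kummerSum (-(1 / 4)) (-(1 / 2)) x
  have h4 := hasSum_kummerSum (7 / 4) (3 / 2) x
  norm_num only at h1
  have h := ((h1.mul_left 4).add (h2.mul_left 2)).add (h3.mul_left 4)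
  rw [← (h.congr_fun fun n => ?_).unique (h4.mul_left 8)]
  · ring
  have e1 := natCast_add_quarter_ne_zero n (-1) (by decide)
  have e2 := natCast_add_quarter_ne_zero n 3 (by decide)
  have e3 := natCast_add_quarter_ne_zero n (-2) (by decide)
  have e4 := natCast_add_quarter_ne_zero n 2 (by decide)
  have k1 := kummerCoeff_add_one_left (a := -(1 / 4)) (3 / 2) (n := n)
    (by convert e1 using 2; norm_num)
  have k2 := kummerCoeff_add_one_left (a := 3 / 4) (3 / 2) (n := n)
    (by convert e2 using 2; norm_num)
  have k3 := kummerCoeff_eq_mul_add_one_right (-(1 / 4)) (b := -(1 / 2)) (n := n)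
    (by convert e3 using 2; norm_num)
  have k4 := kummerCoeff_eq_mul_add_one_right (-(1 / 4)) (b := 1 / 2) (n := n)
    (by convert e4 using 2; norm_num)
  norm_num only at k1 k2 k3 k4
  rw [k2, k1, k3, k4]
  ring

theorem besselI_sq_div_eight {ν : ℝ} (hν : ∀ n : ℕ, (n : ℝ) + (2 * ν + 1) ≠ 0) {κ : ℝ}
    (hκ : κ ≠ 0) :
    besselI ν (κ ^ 2 / 8) = Real.exp (κ ^ 2 / 8) / √π * (|κ| / 2) ^ (2 * ν) *
      kummerSum (ν + 1 / 2) (2 * ν + 1) (-(κ ^ 2 / 4)) := by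
  have h := exp_mul_tsum_kummerCoeff hν (x := κ ^ 2 / 8) (by positivity)
  have h0 : 0 < |κ| / 2 := by positivity
  have e : 2 * (κ ^ 2 / 8) = (|κ| / 2) ^ (2 : ℝ) := by
    rw [rpow_two, div_pow, sq_abs]
    ring
  rw [e, ← rpow_mul h0.le, mul_neg, rpow_neg h0.le,
    show -2 * (κ ^ 2 / 8) = -(κ ^ 2 / 4) by ring] at h
  have h1 : (0 : ℝ) < (|κ| / 2) ^ (2 * ν) := by positivity
  have h2 : 0 < √π := by positivity
  rw [kummerSum, div_mul_eq_mul_div, div_mul_eq_mul_div, mul_right_comm, h]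
  field_simp

/-- Termwise integration of a power series against a generalized Gaussian weight. -/
theorem hasSum_integral_exp_neg_sq_mul_rpow {s : ℝ} (hs : -1 < s) (a : ℕ → ℝ) (d : ℕ) (g : ℝ → ℝ)
    (hg : ∀ z, HasSum (fun k => a k * z ^ (2 * k + d)) (g z))
    (hsum : Summable fun k : ℕ => ‖a k * Gamma (k + (d + s + 1) / 2)‖) :
    HasSum (fun k : ℕ => a k * Gamma (k + (d + s + 1) / 2) / 2)
      (∫ z in Set.Ioi (0 : ℝ), Real.exp (-z ^ 2) * z ^ s * g z) := by
  have hq : ∀ k : ℕ, -1 < s + (2 * k + d : ℕ) := fun k => by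
    have : (0 : ℝ) ≤ (2 * k + d : ℕ) := Nat.cast_nonneg _
    linarith
  have hpow : ∀ k : ℕ, ∀ z ∈ Set.Ioi (0 : ℝ),
      Real.exp (-z ^ 2) * z ^ s * (a k * z ^ (2 * k + d)) =
        a k * (z ^ (s + (2 * k + d : ℕ)) * Real.exp (-z ^ (2 : ℝ))) := fun k z hz => by
    rw [rpow_add hz, rpow_natCast, rpow_two]
    ring
  have hint : ∀ k : ℕ, ∫ z in Set.Ioi (0 : ℝ), z ^ (s + (2 * k + d : ℕ)) * Real.exp (-z ^ (2 : ℝ)) =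
      Gamma (k + (d + s + 1) / 2) / 2 := fun k => by
    rw [integral_rpow_mul_exp_neg_rpow two_pos (hq k)]
    push_cast
    rw [show (s + (2 * k + d) + 1) / 2 = k + (d + s + 1) / 2 by ring]
    ring
  have key := hasSum_integral_of_summable_integral_norm (μ := volume.restrict (Set.Ioi (0 : ℝ)))
    (F := fun k z => Real.exp (-z ^ 2) * z ^ s * (a k * z ^ (2 * k + d))) (fun k => ?_) ?_
  · simp only [tsum_mul_left, (hg _).tsum_eq] at key
    refine key.congr_fun fun k => ?_
    rw [setIntegral_congr_fun measurableSet_Ioi (hpow k), integral_const_mul, hint, mul_div_assoc]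
  · exact IntegrableOn.congr_fun
      (Integrable.const_mul (integrableOn_rpow_mul_exp_neg_rpow (hq k) two_pos) (a k))
      (fun z hz => (hpow k z hz).symm) measurableSet_Ioi
  · refine (hsum.div_const 2).congr fun k => ?_
    have h : ∀ z ∈ Set.Ioi (0 : ℝ), ‖Real.exp (-z ^ 2) * z ^ s * (a k * z ^ (2 * k + d))‖ =
        ‖a k‖ * (z ^ (s + (2 * k + d : ℕ)) * Real.exp (-z ^ (2 : ℝ))) := fun z hz => by
      have hz' : (0 : ℝ) < z := hz
      rw [hpow k z hz, norm_mul, Real.norm_of_nonneg (r := _ * _) (by positivity)]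
    have hpos : 0 < Gamma (k + (d + s + 1) / 2) := Gamma_pos_of_pos (by
      have := (Nat.cast_nonneg k : (0 : ℝ) ≤ k)
      have := (Nat.cast_nonneg d : (0 : ℝ) ≤ d)
      linarith)
    rw [setIntegral_congr_fun measurableSet_Ioi h, integral_const_mul, hint, norm_mul,
      Real.norm_of_nonneg hpos.le, mul_div_assoc]

theorem factorial_two_mul_mul_sqrt_pi (k : ℕ) :
    ((2 * k).factorial : ℝ) * √π = 4 ^ k * (Gamma (k + 1 / 2) * k.factorial) := by
  have h := Gamma_mul_Gamma_add_half ((k : ℝ) + 1 / 2)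
  rw [show (k : ℝ) + 1 / 2 + 1 / 2 = k + 1 by ring, Gamma_nat_eq_factorial,
    show 2 * ((k : ℝ) + 1 / 2) = (2 * k : ℕ) + 1 by push_cast; ring, Gamma_nat_eq_factorial,
    show (1 : ℝ) - ((2 * k : ℕ) + 1) = -(2 * k : ℕ) by ring, rpow_neg two_pos.le, rpow_natCast,
    pow_mul] at h
  rw [h]
  norm_num
  field_simp

theorem factorial_two_mul_add_one_mul_sqrt_pi (k : ℕ) :
    ((2 * k + 1).factorial : ℝ) * √π = 2 * 4 ^ k * (Gamma (k + 3 / 2) * k.factorial) := by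
  rw [Nat.factorial_succ, show (k : ℝ) + 3 / 2 = k + 1 / 2 + 1 by ring,
    Gamma_add_one (by positivity)]
  push_cast
  linear_combination (2 * (k : ℝ) + 1) * factorial_two_mul_mul_sqrt_pi k

theorem integral_exp_neg_sq_mul_rpow_mul_cos {s : ℝ} (hs : -1 < s) (κ : ℝ) :
    ∫ z in Set.Ioi (0 : ℝ), Real.exp (-z ^ 2) * z ^ s * Real.cos (z * κ) =
      √π / 2 * kummerSum ((s + 1) / 2) (1 / 2) (-(κ ^ 2 / 4)) := by
  have hcoef : ∀ k : ℕ, (-1) ^ k * κ ^ (2 * k) / (2 * k).factorial *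
      Gamma (k + ((0 : ℕ) + s + 1) / 2) =
      √π * (kummerCoeff ((s + 1) / 2) (1 / 2) k * (-(κ ^ 2 / 4)) ^ k) := fun k => by
    have h1 : 0 < Gamma ((k : ℝ) + 1 / 2) := Gamma_pos_of_pos (by positivity)
    have h2 : ((2 * k).factorial : ℝ) = 4 ^ k * (Gamma (k + 1 / 2) * k.factorial) / √π := by
      rw [eq_div_iff (by positivity), factorial_two_mul_mul_sqrt_pi]
    rw [h2, kummerCoeff, Nat.cast_zero, zero_add, neg_pow (κ ^ 2 / 4), div_pow, pow_mul]
    field_simp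
  have h := hasSum_integral_exp_neg_sq_mul_rpow hs
    (fun k : ℕ => (-1) ^ k * κ ^ (2 * k) / (2 * k).factorial) 0 (fun z => Real.cos (z * κ))
    (fun z => (Real.hasSum_cos (z * κ)).congr_fun fun k => by
      rw [mul_pow, add_zero]
      ring)
    (by
      simp only [hcoef, norm_mul √π]
      exact (summable_norm_kummerCoeff_mul_pow _ _ _).mul_left _)
  simp only [hcoef] at h
  rw [h.unique (((hasSum_kummerSum _ _ _).mul_left √π).div_const 2)]
  ring

theorem integral_exp_neg_sq_mul_rpow_mul_sin {s : ℝ} (hs : -1 < s) (κ : ℝ) :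
    ∫ z in Set.Ioi (0 : ℝ), Real.exp (-z ^ 2) * z ^ s * Real.sin (z * κ) =
      √π * κ / 4 * kummerSum (s / 2 + 1) (3 / 2) (-(κ ^ 2 / 4)) := by
  have hcoef : ∀ k : ℕ, (-1) ^ k * κ ^ (2 * k + 1) / (2 * k + 1).factorial *
      Gamma (k + ((1 : ℕ) + s + 1) / 2) =
      √π * κ / 2 * (kummerCoeff (s / 2 + 1) (3 / 2) k * (-(κ ^ 2 / 4)) ^ k) := fun k => by
    have h1 : 0 < Gamma ((k : ℝ) + 3 / 2) := Gamma_pos_of_pos (by positivity)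
    have h2 : ((2 * k + 1).factorial : ℝ) =
        2 * 4 ^ k * (Gamma (k + 3 / 2) * k.factorial) / √π := by
      rw [eq_div_iff (by positivity), factorial_two_mul_add_one_mul_sqrt_pi]
    rw [h2, kummerCoeff, Nat.cast_one, neg_pow (κ ^ 2 / 4), div_pow, pow_succ, pow_mul,
      show (1 + s + 1) / 2 = s / 2 + 1 by ring]
    field_simp
  have h := hasSum_integral_exp_neg_sq_mul_rpow hs
    (fun k : ℕ => (-1) ^ k * κ ^ (2 * k + 1) / (2 * k + 1).factorial) 1
    (fun z => Real.sin (z * κ))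
    (fun z => (Real.hasSum_sin (z * κ)).congr_fun fun k => by
      rw [mul_pow]
      ring)
    (by
      simp only [hcoef, norm_mul (√π * κ / 2)]
      exact (summable_norm_kummerCoeff_mul_pow _ _ _).mul_left _)
  simp only [hcoef] at h
  rw [h.unique (((hasSum_kummerSum _ _ _).mul_left (√π * κ / 2)).div_const 2)]
  ring

theorem integrableOn_exp_neg_sq_mul_rpow_mul {s : ℝ} (hs : -1 < s) {g : ℝ → ℝ}
    (hg : Continuous g) (hb : ∀ z, |g z| ≤ 1) :
    IntegrableOn (fun z => Real.exp (-z ^ 2) * z ^ s * g z) (Set.Ioi 0) := by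
  have h : IntegrableOn (fun z : ℝ => Real.exp (-z ^ 2) * z ^ s) (Set.Ioi 0) := by
    refine (integrableOn_rpow_mul_exp_neg_rpow hs two_pos).congr_fun (fun z _ => ?_)
      measurableSet_Ioi
    simp only [rpow_two]
    ring
  exact h.mul_bdd hg.aestronglyMeasurable (ae_of_all _ hb)

/-- The profile function `Φ₃(κ) = ∫_0^∞ e^{−z²} z^{3/2} sin(zκ − π/4) dz` expressed through
modified Bessel functions, with `η = κ²/8`. -/
theorem phi3_bessel_formula (κ : ℝ) (hκ : κ ≠ 0) :
    ∫ z in Set.Ioi (0 : ℝ), Real.exp (-z ^ 2) * z ^ ((3 : ℝ) / 2) * Real.sin (z * κ - π / 4) =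
      (π / 32) * Real.exp (-(κ ^ 2 / 8)) * |κ| ^ ((1 : ℝ) / 2) *
        ((κ ^ 2 - 2) * besselI (-(1 / 4)) (κ ^ 2 / 8) - κ ^ 2 * besselI (3 / 4) (κ ^ 2 / 8) -
          Real.sign κ * ((κ ^ 2 - 2) * besselI (1 / 4) (κ ^ 2 / 8) -
            κ ^ 2 * besselI (-(3 / 4)) (κ ^ 2 / 8))) := by
  have hs : (-1 : ℝ) < 3 / 2 := by norm_num
  have hL : ∫ z in Set.Ioi (0 : ℝ),
      Real.exp (-z ^ 2) * z ^ ((3 : ℝ) / 2) * Real.sin (z * κ - π / 4) =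
      √2 / 2 * (√π * κ / 4 * kummerSum (7 / 4) (3 / 2) (-(κ ^ 2 / 4)) -
        √π / 2 * kummerSum (5 / 4) (1 / 2) (-(κ ^ 2 / 4))) := by
    have e1 := integral_exp_neg_sq_mul_rpow_mul_sin hs κ
    have e2 := integral_exp_neg_sq_mul_rpow_mul_cos hs κ
    norm_num only at e1 e2
    rw [← e1, ← e2, ← integral_sub
      (integrableOn_exp_neg_sq_mul_rpow_mul hs (by fun_prop) fun z => abs_sin_le_one _)
      (integrableOn_exp_neg_sq_mul_rpow_mul hs (by fun_prop) fun z => abs_cos_le_one _),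
      ← integral_const_mul]
    congr 1
    ext z
    rw [sin_sub, cos_pi_div_four, sin_pi_div_four]
    ring
  have hB : ∀ j : ℤ, ¬ (4 : ℤ) ∣ 2 * (j + 2) → ∀ n : ℕ, (n : ℝ) + (2 * (j / 4) + 1) ≠ 0 :=
    fun j hj n => by
      convert natCast_add_quarter_ne_zero n _ hj using 2
      push_cast
      ring
  have b1 := besselI_sq_div_eight (hB (-1) (by decide)) hκ
  have b2 := besselI_sq_div_eight (hB 3 (by decide)) hκ
  have b3 := besselI_sq_div_eight (hB 1 (by decide)) hκ
  have b4 := besselI_sq_div_eight (hB (-3) (by decide)) hκ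
  have c1 := kummerSum_contiguous_half (-(κ ^ 2 / 4))
  have c2 := kummerSum_contiguous_three_halves (-(κ ^ 2 / 4))
  push_cast at b1 b2 b3 b4
  norm_num only at b1 b2 b3 b4 c1 c2 ⊢
  obtain ⟨w, hw, hκw⟩ : ∃ w : ℝ, 0 < w ∧ |κ| = 2 * w ^ 2 :=
    ⟨√(|κ| / 2), by positivity, by rw [sq_sqrt (by positivity)]; ring⟩
  have hpw : ∀ r : ℝ, (|κ| / 2) ^ r = w ^ (2 * r) := fun r => by
    rw [hκw, mul_div_cancel_left₀ _ two_ne_zero, rpow_mul hw.le, rpow_two]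
  have hsq : |κ| ^ ((1 : ℝ) / 2) = √2 * w := by
    rw [← sqrt_eq_rpow, hκw, sqrt_mul two_pos.le, sqrt_sq hw.le]
  have hκ2 : κ ^ 2 = 4 * w ^ 4 := by rw [← sq_abs, hκw]; ring
  have hsgn : κ = Real.sign κ * (2 * w ^ 2) := by
    rw [← hκw]
    rcases lt_or_gt_of_ne hκ with h | h
    · rw [sign_of_neg h, abs_of_neg h]; ring
    · rw [sign_of_pos h, abs_of_pos h]; ring
  have r1 : w ^ (2 * (-(1 / 2)) : ℝ) = w⁻¹ := by
    rw [show (2 * (-(1 / 2)) : ℝ) = -1 by norm_num, rpow_neg_one]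
  have r2 : w ^ (2 * (3 / 2) : ℝ) = w ^ 3 := by
    rw [show (2 * (3 / 2) : ℝ) = (3 : ℕ) by norm_num, rpow_natCast]
  have r3 : w ^ (2 * (1 / 2) : ℝ) = w := by
    rw [show (2 * (1 / 2) : ℝ) = 1 by norm_num, rpow_one]
  have r4 : w ^ (2 * (-(3 / 2)) : ℝ) = (w ^ 3)⁻¹ := by
    rw [mul_neg, rpow_neg hw.le, r2]
  rw [hL, b1, b2, b3, b4, hsq, hpw, hpw, hpw, hpw, r1, r2, r3, r4, Real.exp_neg,
    (eq_div_iff_mul_eq (by norm_num)).2 ((mul_comm _ _).trans c1.symm),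
    (eq_div_iff_mul_eq (by norm_num)).2 ((mul_comm _ _).trans c2.symm)]
  generalize kummerSum (1 / 4) (1 / 2) (-(κ ^ 2 / 4)) = K₁
  generalize kummerSum (5 / 4) (5 / 2) (-(κ ^ 2 / 4)) = K₂
  generalize kummerSum (3 / 4) (3 / 2) (-(κ ^ 2 / 4)) = K₃
  generalize kummerSum (-(1 / 4)) (-(1 / 2)) (-(κ ^ 2 / 4)) = K₄
  have hE : Real.exp (κ ^ 2 / 8) ≠ 0 := (Real.exp_pos _).ne'
  generalize Real.exp (κ ^ 2 / 8) = E at hE ⊢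
  have hP : √π ≠ 0 := by positivity
  have hP2 : π = √π ^ 2 := (sq_sqrt pi_pos.le).symm
  generalize √π = P at hP hP2 ⊢
  generalize Real.sign κ = t at hsgn ⊢
  rw [hP2, hκ2, hsgn]
  field_simp
  ring
end
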